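/- Let α = (α_n)_{n≥0} be a bounded sequence of positive real numbers, extended by α_{−1} = α_{−2} = α_{−3} = α_{−4} = 0, and let W_α be the associated unilateral weighted shift on ℓ²(ℕ, ℂ). Define, for i ≥ 0: u_i := α_i² − α_{i−1}², w_i := α_i²(α_{i+1}² − α_{i−1}²)², v_i := α_i²α_{i+1}² − α_{i−1}²α_{i−2}², s_i := α_i²α_{i+1}²(α_{i+2}² − α_{i−1}²)², t_i := α_i²(α_{i+1}²α_{i+2}² − α_{i−1}²α_{i−2}²)², p_i := α_i²α_{i+1}²α_{i+2}² − α_{i−1}²α_{i−2}²α_{i−3}², q_i := α_i²α_{i+1}²α_{i+2}²(α_{i+3}² − α_{i−1}²)², f_i := α_i²α_{i+1}²(α_{i+2}²α_{i+3}² − α_{i−1}²α_{i−2}²)², g_i := α_i²(α_{i+1}²α_{i+2}²α_{i+3}² − α_{i−1}²α_{i−2}²α_{i−3}²)², r_i := α_i²α_{i+1}²α_{i+2}²α_{i+3}² − α_{i−1}²α_{i−2}²α_{i−3}²α_{i−4}². Let Θ₁ be the 2×2 real matrix with rows (p₀, √g₀) and (√g₀, r₁); let Θ₂ be the 3×3 real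 matrix with rows (v₀, √t₀, √f₀), (√t₀, p₁, √g₁), (√f₀, √g₁, r₂); and for i ≥ 0 let Δ_i be the 4×4 real matrix with rows (u_i, √w_i, √s_i, √q_i), (√w_i, v_{i+1}, √t_{i+1}, √f_{i+1}), (√s_i, √t_{i+1}, p_{i+2}, √g_{i+2}), (√q_i, √f_{i+1}, √g_{i+2}, r_{i+3}). Then W_α is quartically hyponormal if and only if for every a, b, c ∈ ℂ and every x = (x_n)_{n≥0} ∈ ℓ²(ℕ, ℂ) the quantity Δ := |c|² r₀ |x₀|² + ⟨Θ₁ (b̄x₀, c̄x₁)ᵀ, (b̄x₀, c̄x₁)ᵀ⟩ + ⟨Θ₂ (āx₀, b̄x₁, c̄x₂)ᵀ, (āx₀, b̄x₁, c̄x₂)ᵀ⟩ + Σ_{i=0}^{∞} ⟨Δ_i (x_i, āx_{i+1}, b̄x_{i+2}, c̄x_{i+3})ᵀ, (x_i, āx_{i+1}, b̄x_{i+2}, c̄x_{i+3})ᵀ⟩ satisfies Δ ≥ 0. -/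

import Mathlib

open scoped ComplexOrder
open ContinuousLinearMap

noncomputable section

variable {E : Type*} [NormedAddCommGroup E] [InnerProductSpace ℂ E] [CompleteSpace E]

/-- `T` is hyponormal: `‖T* x‖ ≤ ‖T x‖` for all `x`. -/
def Hyponormal (T : E →L[ℂ] E) : Prop :=
  ∀ x : E, ‖adjoint T x‖ ≤ ‖T x‖

/-- `T` is `k`-hyponormal: `∑_{i,j=1}^k ⟨(T*^j T^i − T^i T*^j) x_j, x_i⟩ ≥ 0`. -/
def KHyponormal (k : ℕ) (T : E →L[ℂ] E) : Prop :=
  ∀ x : Fin k → E,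
    (0 : ℂ) ≤ ∑ i, ∑ j,
      (inner ℂ (x i) ((adjoint T ^ (j.1 + 1) * T ^ (i.1 + 1)
        - T ^ (i.1 + 1) * adjoint T ^ (j.1 + 1)) (x j)) : ℂ)

/-- `T` is weakly `k`-hyponormal: every `∑_{j=1}^k λ_j T^j` is hyponormal. -/
def WeaklyKHyponormal (k : ℕ) (T : E →L[ℂ] E) : Prop :=
  ∀ lam : Fin k → ℂ, Hyponormal (∑ j : Fin k, lam j • T ^ (j.1 + 1))

/-- The Hilbert space `ℓ²(ℕ, ℂ)`. -/
abbrev H : Type := lp (fun _ : ℕ => ℂ) 2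

/-- The canonical orthonormal basis vectors of `ℓ²(ℕ, ℂ)`. -/
def e (n : ℕ) : H := lp.single 2 n 1

/-- `W` is the unilateral weighted shift with weight sequence `α`. -/
def IsWeightedShift (α : ℕ → ℝ) (W : H →L[ℂ] H) : Prop :=
  ∀ n : ℕ, W (e n) = (α n : ℂ) • e (n + 1)

/-- Squared weights `α_n²`, extended by `0` for negative indices
(`α_{-1} = α_{-2} = α_{-3} = α_{-4} = 0`). -/
def wsq (α : ℕ → ℝ) : ℤ → ℝ := fun n => if 0 ≤ n then (α n.toNat) ^ 2 else 0

def u (α : ℕ → ℝ) (i : ℤ) : ℝ := wsq α i - wsq α (i - 1)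

def w (α : ℕ → ℝ) (i : ℤ) : ℝ := wsq α i * (wsq α (i + 1) - wsq α (i - 1)) ^ 2

def v (α : ℕ → ℝ) (i : ℤ) : ℝ := wsq α i * wsq α (i + 1) - wsq α (i - 1) * wsq α (i - 2)

def s (α : ℕ → ℝ) (i : ℤ) : ℝ :=
  wsq α i * wsq α (i + 1) * (wsq α (i + 2) - wsq α (i - 1)) ^ 2

def t (α : ℕ → ℝ) (i : ℤ) : ℝ :=
  wsq α i * (wsq α (i + 1) * wsq α (i + 2) - wsq α (i - 1) * wsq α (i - 2)) ^ 2

def p (α : ℕ → ℝ) (i : ℤ) : ℝ :=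
  wsq α i * wsq α (i + 1) * wsq α (i + 2) - wsq α (i - 1) * wsq α (i - 2) * wsq α (i - 3)

def q (α : ℕ → ℝ) (i : ℤ) : ℝ :=
  wsq α i * wsq α (i + 1) * wsq α (i + 2) * (wsq α (i + 3) - wsq α (i - 1)) ^ 2

def f (α : ℕ → ℝ) (i : ℤ) : ℝ :=
  wsq α i * wsq α (i + 1) * (wsq α (i + 2) * wsq α (i + 3) - wsq α (i - 1) * wsq α (i - 2)) ^ 2

def g (α : ℕ → ℝ) (i : ℤ) : ℝ :=
  wsq α i * (wsq α (i + 1) * wsq α (i + 2) * wsq α (i + 3)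
    - wsq α (i - 1) * wsq α (i - 2) * wsq α (i - 3)) ^ 2

def r (α : ℕ → ℝ) (i : ℤ) : ℝ :=
  wsq α i * wsq α (i + 1) * wsq α (i + 2) * wsq α (i + 3)
    - wsq α (i - 1) * wsq α (i - 2) * wsq α (i - 3) * wsq α (i - 4)

/-- The 2×2 matrix `Θ₁`. -/
def Theta1 (α : ℕ → ℝ) : Matrix (Fin 2) (Fin 2) ℝ :=
  !![p α 0, Real.sqrt (g α 0);
     Real.sqrt (g α 0), r α 1]

/-- The 3×3 matrix `Θ₂`. -/
def Theta2 (α : ℕ → ℝ) : Matrix (Fin 3) (Fin 3) ℝ :=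
  !![v α 0, Real.sqrt (t α 0), Real.sqrt (f α 0);
     Real.sqrt (t α 0), p α 1, Real.sqrt (g α 1);
     Real.sqrt (f α 0), Real.sqrt (g α 1), r α 2]

/-- The 4×4 matrices `Δ_i`, `i ≥ 0`. -/
def DeltaMat (α : ℕ → ℝ) (i : ℕ) : Matrix (Fin 4) (Fin 4) ℝ :=
  !![u α i, Real.sqrt (w α i), Real.sqrt (s α i), Real.sqrt (q α i);
     Real.sqrt (w α i), v α (i + 1), Real.sqrt (t α (i + 1)), Real.sqrt (f α (i + 1));
     Real.sqrt (s α i), Real.sqrt (t α (i + 1)), p α (i + 2), Real.sqrt (g α (i + 2));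
     Real.sqrt (q α i), Real.sqrt (f α (i + 1)), Real.sqrt (g α (i + 2)), r α (i + 3)]

/-- The (real-valued) quadratic form `⟨M y, y⟩` of a real symmetric matrix `M`
acting entrywise on a complex vector `y`. -/
def qform {n : ℕ} (M : Matrix (Fin n) (Fin n) ℝ) (y : Fin n → ℂ) : ℝ :=
  ∑ i, ∑ j, M i j * (y j * (starRingEnd ℂ) (y i)).re

/-- Extension by zero of a sequence indexed by `ℕ` to a sequence indexed by `ℤ`. -/
def zext {R : Type*} [Zero R] (x : ℕ → R) (n : ℤ) : R := if 0 ≤ n then x n.toNat else 0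

@[simp] lemma zext_natCast {R : Type*} [Zero R] (x : ℕ → R) (n : ℕ) : zext x n = x n := by
  simp [zext]

lemma zext_of_neg {R : Type*} [Zero R] (x : ℕ → R) {n : ℤ} (hn : n < 0) : zext x n = 0 := by
  simp [zext, hn]

lemma wsq_eq_zext_sq (α : ℕ → ℝ) (n : ℤ) : wsq α n = zext α n ^ 2 := by
  by_cases hn : 0 ≤ n <;> simp [wsq, zext, hn]

lemma zext_nonneg {α : ℕ → ℝ} (hα : ∀ n, 0 ≤ α n) (n : ℤ) : 0 ≤ zext α n := by
  unfold zext
  split_ifs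
  exacts [hα _, le_rfl]

lemma zext_monotone {α : ℕ → ℝ} (hα : ∀ n, 0 ≤ α n) (hmono : Monotone α) :
    Monotone (zext α) := by
  intro m n hmn
  by_cases hm : 0 ≤ m
  · simp only [zext, hm, hm.trans hmn, if_true]
    exact hmono (Int.toNat_le_toNat hmn)
  · rw [zext_of_neg α (not_le.mp hm)]
    exact zext_nonneg hα n

/-- A series over `ℤ` whose terms vanish at negative indices is a series over `ℕ`. -/
lemma hasSum_int_iff_nat {R : Type*} [AddCommMonoid R] [TopologicalSpace R] {h : ℤ → R} {S : R}
    (hh : ∀ n < 0, h n = 0) : HasSum h S ↔ HasSum (fun n : ℕ => h n) S := by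
  refine (Function.Injective.hasSum_iff Nat.cast_injective fun n hn => hh n ?_).symm
  by_contra! h0
  exact hn ⟨n.toNat, by simpa using h0⟩

lemma hasSum_inner_zext (y z : H) :
    HasSum (fun n : ℤ => zext z n * (starRingEnd ℂ) (zext y n)) (inner ℂ y z) := by
  rw [hasSum_int_iff_nat fun n hn => by simp [zext_of_neg _ hn]]
  simpa [RCLike.inner_apply] using lp.hasSum_inner (𝕜 := ℂ) y z

lemma inner_e (n : ℕ) (x : H) : inner ℂ (e n) x = x n := by
  simp [e, lp.inner_single_left]

lemma adjoint_weightedShift_apply {α : ℕ → ℝ} {W : H →L[ℂ] H} (hW : IsWeightedShift α W)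
    (x : H) (n : ℕ) : adjoint W x n = α n * x (n + 1) := by
  rw [← inner_e, adjoint_inner_right, hW, inner_smul_left, inner_e, Complex.conj_ofReal]

lemma weightedShift_apply_zero {α : ℕ → ℝ} {W : H →L[ℂ] H} (hW : IsWeightedShift α W)
    (x : H) : W x 0 = 0 := by
  have h0 : adjoint W (e 0) = 0 := by
    ext m
    simp [adjoint_weightedShift_apply hW, e]
  rw [← inner_e, ← adjoint_inner_left, h0, inner_zero_left]

lemma adjoint_weightedShift_e_succ {α : ℕ → ℝ} {W : H →L[ℂ] H} (hW : IsWeightedShift α W)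
    (n : ℕ) : adjoint W (e (n + 1)) = (α n : ℂ) • e n := by
  ext m
  rw [adjoint_weightedShift_apply hW, lp.coeFn_smul, Pi.smul_apply, smul_eq_mul]
  by_cases hmn : m = n
  · subst hmn; simp [e]
  · simp [e, hmn]

lemma weightedShift_apply_succ {α : ℕ → ℝ} {W : H →L[ℂ] H} (hW : IsWeightedShift α W)
    (x : H) (n : ℕ) : W x (n + 1) = α n * x n := by
  rw [← inner_e, ← adjoint_inner_left, adjoint_weightedShift_e_succ hW, inner_smul_left,
    inner_e, Complex.conj_ofReal]

lemma zext_weightedShift {α : ℕ → ℝ} {W : H →L[ℂ] H} (hW : IsWeightedShift α W)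
    (x : H) (n : ℤ) : zext (W x) n = zext α (n - 1) * zext x (n - 1) := by
  rcases lt_trichotomy n 0 with hn | rfl | hn
  · simp [zext_of_neg _ hn, zext_of_neg _ (show n - 1 < 0 by lia)]
  · simpa [zext] using weightedShift_apply_zero hW x
  · obtain ⟨m, rfl⟩ : ∃ m : ℕ, n = m + 1 := ⟨(n - 1).toNat, by lia⟩
    have := zext_natCast (W x) (m + 1)
    push_cast at this
    rw [this, weightedShift_apply_succ hW]
    simp

lemma zext_adjoint_weightedShift {α : ℕ → ℝ} {W : H →L[ℂ] H} (hW : IsWeightedShift α W)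
    (x : H) (n : ℤ) : zext (adjoint W x) n = zext α n * zext x (n + 1) := by
  rcases lt_or_ge n 0 with hn | hn
  · simp [zext_of_neg _ hn]
  · lift n to ℕ using hn
    have := zext_natCast x (n + 1)
    push_cast at this
    rw [this, zext_natCast, zext_natCast, adjoint_weightedShift_apply hW]

/-- The product `a n * a (n + 1) * ⋯ * a (n + k - 1)` of `k` consecutive weights. -/
def wprod (a : ℤ → ℝ) (k : ℕ) (n : ℤ) : ℝ := ∏ l ∈ Finset.range k, a (n + l)

lemma zext_weightedShift_pow {α : ℕ → ℝ} {W : H →L[ℂ] H} (hW : IsWeightedShift α W)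
    (k : ℕ) (x : H) (n : ℤ) :
    zext ((W ^ k) x) n = wprod (zext α) k (n - k) * zext x (n - k) := by
  induction k generalizing x with
  | zero => simp [wprod]
  | succ k ih =>
    rw [pow_succ, mul_apply_eq_comp, ih, zext_weightedShift hW, wprod, wprod,
      Finset.prod_range_succ']
    push_cast
    have h1 : ∀ l : ℤ, n - (k + 1) + (l + 1) = n - k + l := fun l => by ring
    rw [show n - (k + 1) + 0 = n - k - 1 by ring, show n - ((k : ℤ) + 1) = n - k - 1 by ring]
    simp only [← h1]
    ring_nf

lemma zext_adjoint_weightedShift_pow {α : ℕ → ℝ} {W : H →L[ℂ] H} (hW : IsWeightedShift α W)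
    (k : ℕ) (x : H) (n : ℤ) :
    zext ((adjoint W ^ k) x) n = wprod (zext α) k n * zext x (n + k) := by
  induction k generalizing x with
  | zero => simp [wprod]
  | succ k ih =>
    rw [pow_succ, mul_apply_eq_comp, ih, zext_adjoint_weightedShift hW, wprod, wprod,
      Finset.prod_range_succ]
    push_cast
    rw [add_assoc n]
    ring

lemma adjoint_sum_smul_pow {d : ℕ} (lam : Fin d → ℂ) (T : E →L[ℂ] E) :
    adjoint (∑ j : Fin d, lam j • T ^ (j.1 + 1))
      = ∑ j : Fin d, (starRingEnd ℂ) (lam j) • adjoint T ^ (j.1 + 1) := by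
  simp [← star_eq_adjoint]

lemma norm_sq_sum_smul {F : Type*} [NormedAddCommGroup F] [InnerProductSpace ℂ F] {d : ℕ}
    (c : Fin d → ℂ) (y : Fin d → F) :
    ‖∑ j, c j • y j‖ ^ 2
      = ∑ j, ∑ k, (c j * (starRingEnd ℂ) (c k) * inner ℂ (y k) (y j)).re := by
  rw [← inner_self_eq_norm_sq (𝕜 := ℂ), inner_sum]
  simp only [sum_inner, inner_smul_left, inner_smul_right, RCLike.re_to_complex, Complex.re_sum,
    Finset.mul_sum, mul_assoc]

/-- The self-commutator form of a polynomial in a weighted shift, as a series of finite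
quadratic forms. -/
lemma hasSum_selfCommutator {α : ℕ → ℝ} {W : H →L[ℂ] H} (hW : IsWeightedShift α W) {d : ℕ}
    (lam : Fin d → ℂ) (x : H) :
    HasSum (fun i : ℤ => ∑ j : Fin d, ∑ k : Fin d,
        (wprod (zext α) (j + 1) (i + (k + 1)) * wprod (zext α) (k + 1) (i + (j + 1))
          - wprod (zext α) (j + 1) i * wprod (zext α) (k + 1) i)
        * ((starRingEnd ℂ) (lam k) * zext x (i + (k + 1))
          * (starRingEnd ℂ) ((starRingEnd ℂ) (lam j) * zext x (i + (j + 1)))).re)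
      (‖(∑ j : Fin d, lam j • W ^ (j.1 + 1)) x‖ ^ 2
        - ‖adjoint (∑ j : Fin d, lam j • W ^ (j.1 + 1)) x‖ ^ 2) := by
  have hT : (∑ j : Fin d, lam j • W ^ (j.1 + 1)) x
      = ∑ j : Fin d, lam j • (W ^ (j.1 + 1)) x := by simp
  have hT' : adjoint (∑ j : Fin d, lam j • W ^ (j.1 + 1)) x
      = ∑ j : Fin d, (starRingEnd ℂ) (lam j) • (adjoint W ^ (j.1 + 1)) x := by
    rw [adjoint_sum_smul_pow]
    simp
  rw [hT, hT', norm_sq_sum_smul, norm_sq_sum_smul]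
  rw [Finset.sum_comm (f := fun j k : Fin d => ((starRingEnd ℂ) (lam j)
    * (starRingEnd ℂ) ((starRingEnd ℂ) (lam k)) * inner ℂ _ _).re)]
  simp only [← Finset.sum_sub_distrib]
  refine hasSum_sum fun j _ => hasSum_sum fun k _ => ?_
  have h1 := hasSum_inner_zext ((W ^ (k.1 + 1)) x) ((W ^ (j.1 + 1)) x)
  rw [← (Equiv.addRight ((j : ℤ) + k + 2)).hasSum_iff] at h1
  have h2 := hasSum_inner_zext ((adjoint W ^ (j.1 + 1)) x) ((adjoint W ^ (k.1 + 1)) x)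
  have h3 := (Complex.hasSum_re (h1.mul_left (lam j * (starRingEnd ℂ) (lam k)))).sub
    (Complex.hasSum_re (h2.mul_left
      ((starRingEnd ℂ) (lam k) * (starRingEnd ℂ) ((starRingEnd ℂ) (lam j)))))
  refine Eq.subst (motive := fun h => HasSum h _) (funext fun i => ?_) h3
  symm
  simp only [Function.comp_apply, Equiv.coe_addRight, zext_weightedShift_pow hW,
    zext_adjoint_weightedShift_pow hW]
  push_cast
  rw [show i + ((j : ℤ) + k + 2) - (j + 1) = i + (k + 1) by ring,
    show i + ((j : ℤ) + k + 2) - (k + 1) = i + (j + 1) by ring, ← Complex.sub_re,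
    ← Complex.re_ofReal_mul]
  congr 1
  simp only [map_mul, Complex.conj_conj, Complex.conj_ofReal]
  push_cast
  ring

/-- The matrices `Δ_i` for all integers `i`. -/
def DeltaMatInt (α : ℕ → ℝ) (i : ℤ) : Matrix (Fin 4) (Fin 4) ℝ :=
  !![u α i, √(w α i), √(s α i), √(q α i);
     √(w α i), v α (i + 1), √(t α (i + 1)), √(f α (i + 1));
     √(s α i), √(t α (i + 1)), p α (i + 2), √(g α (i + 2));
     √(q α i), √(f α (i + 1)), √(g α (i + 2)), r α (i + 3)]

lemma DeltaMatInt_apply {α : ℕ → ℝ} (hα : ∀ n, 0 ≤ α n) (hmono : Monotone α) (i : ℤ)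
    (j k : Fin 4) :
    DeltaMatInt α (i + 1) j k
      = wprod (zext α) (j + 1) (i + (k + 1)) * wprod (zext α) (k + 1) (i + (j + 1))
        - wprod (zext α) (j + 1) i * wprod (zext α) (k + 1) i := by
  have hprod (m : ℕ) (n : ℤ) (l : ℕ) : wprod (zext α) m n ≤ wprod (zext α) m (n + (l + 1)) :=
    Finset.prod_le_prod (fun _ _ => zext_nonneg hα _)
      fun _ _ => zext_monotone hα hmono (by lia)
  have hpos (m : ℕ) (n : ℤ) : 0 ≤ wprod (zext α) m n :=
    Finset.prod_nonneg fun _ _ => zext_nonneg hα _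
  have hN (j k : Fin 4) : 0 ≤ wprod (zext α) (j + 1) (i + (k + 1))
      * wprod (zext α) (k + 1) (i + (j + 1))
        - wprod (zext α) (j + 1) i * wprod (zext α) (k + 1) i :=
    sub_nonneg.mpr (mul_le_mul (hprod _ _ _) (hprod _ _ _) (hpos _ _) (hpos _ _))
  fin_cases j <;> fin_cases k <;>
  first
  | refine (congrArg Real.sqrt ?_).trans (Real.sqrt_sq (hN _ _))
    simp [w, s, t, q, f, g, wsq_eq_zext_sq, wprod, Finset.prod_range_succ]
    ring_nf
  | simp [DeltaMatInt, u, v, p, r, wsq_eq_zext_sq, wprod, Finset.prod_range_succ]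
    ring_nf

/-- The vector with entries `conj (lam j) * x_{i+j}`, for an integer `i`. -/
def deltaVec (lam : Fin 4 → ℂ) (x : ℕ → ℂ) (i : ℤ) (j : Fin 4) : ℂ :=
  (starRingEnd ℂ) (lam j) * zext x (i + j)

lemma hasSum_qform_DeltaMatInt {α : ℕ → ℝ} (hα : ∀ n, 0 ≤ α n) (hmono : Monotone α)
    {W : H →L[ℂ] H} (hW : IsWeightedShift α W) (lam : Fin 4 → ℂ) (x : H) :
    HasSum (fun n : ℕ => qform (DeltaMatInt α (n - 3)) (deltaVec lam x (n - 3)))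
      (‖(∑ j : Fin 4, lam j • W ^ (j.1 + 1)) x‖ ^ 2
        - ‖adjoint (∑ j : Fin 4, lam j • W ^ (j.1 + 1)) x‖ ^ 2) := by
  have h := hasSum_selfCommutator hW lam x
  rw [← (Equiv.addRight (-4 : ℤ)).hasSum_iff] at h
  refine (hasSum_int_iff_nat
    (h := fun n : ℤ => qform (DeltaMatInt α (n - 3)) (deltaVec lam x (n - 3))) ?_).mp ?_
  · intro n hn
    have hx (j : Fin 4) : deltaVec lam x (n - 3) j = 0 := by
      rw [deltaVec, zext_of_neg _ (by have := j.is_lt; lia), mul_zero]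
    simp [qform, hx]
  · convert h using 2 with n
    simp only [qform, Function.comp_apply, Equiv.coe_addRight, deltaVec]
    refine Finset.sum_congr rfl fun j _ => Finset.sum_congr rfl fun k _ => ?_
    rw [show n - 3 = n + -4 + 1 by ring, DeltaMatInt_apply hα hmono]
    simp only [add_assoc, add_comm (1 : ℤ)]

/-- The quadratic form `Δ` is the self-commutator form of `W + a W² + b W³ + c W⁴`. -/
lemma Delta_eq_selfCommutator {α : ℕ → ℝ} (hα : ∀ n, 0 ≤ α n) (hmono : Monotone α)
    {W : H →L[ℂ] H} (hW : IsWeightedShift α W) (a b c : ℂ) (x : H) :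
    ‖c‖ ^ 2 * r α 0 * ‖x 0‖ ^ 2
          + qform (Theta1 α) ![(starRingEnd ℂ) b * x 0, (starRingEnd ℂ) c * x 1]
          + qform (Theta2 α)
              ![(starRingEnd ℂ) a * x 0, (starRingEnd ℂ) b * x 1, (starRingEnd ℂ) c * x 2]
          + ∑' i : ℕ, qform (DeltaMat α i)
              ![x i, (starRingEnd ℂ) a * x (i + 1), (starRingEnd ℂ) b * x (i + 2),
                (starRingEnd ℂ) c * x (i + 3)]
      = ‖(∑ j : Fin 4, ![1, a, b, c] j • W ^ (j.1 + 1)) x‖ ^ 2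
        - ‖adjoint (∑ j : Fin 4, ![1, a, b, c] j • W ^ (j.1 + 1)) x‖ ^ 2 := by
  have h := hasSum_qform_DeltaMatInt hα hmono hW ![1, a, b, c] x
  rw [← h.tsum_eq, ← h.summable.sum_add_tsum_nat_add 3, Finset.sum_range_succ,
    Finset.sum_range_succ, Finset.sum_range_one]
  have hz (m : ℤ) (n : ℕ) (hmn : m = n) : zext x m = x n := by simp [hmn]
  congr 1
  · congr 1
    · congr 1
      · simp [qform, Fin.sum_univ_four, deltaVec, DeltaMatInt, zext]
        rw [Complex.sq_norm, Complex.sq_norm, Complex.normSq_apply, Complex.normSq_apply]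
        ring
      · simp [qform, Fin.sum_univ_four, deltaVec, DeltaMatInt, zext, Theta1]
    · simp [qform, Fin.sum_univ_four, Fin.sum_univ_three, deltaVec, DeltaMatInt, zext, Theta2]
  · congr 1 with i
    rw [show ((i + 3 : ℕ) : ℤ) - 3 = i by push_cast; ring]
    refine congrArg (qform _) ?_
    ext j
    fin_cases j
    · simp [deltaVec]
    · simpa [deltaVec] using .inl (hz _ _ (by simp)).symm
    · simpa [deltaVec] using .inl (hz _ _ (by simp)).symm
    · simpa [deltaVec] using .inl (hz _ _ (by simp)).symm

lemma Hyponormal.smul {T : E →L[ℂ] E} (hT : Hyponormal T) (z : ℂ) : Hyponormal (z • T) := by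
  intro x
  rw [map_smulₛₗ]
  simpa [norm_smul] using mul_le_mul_of_nonneg_left (hT x) (norm_nonneg z)

/-- Weak `k`-hyponormality may be tested on polynomials with linear coefficient `1`. -/
lemma weaklyKHyponormal_of_forall_cons_one {k : ℕ} {T : E →L[ℂ] E}
    (h : ∀ lam : Fin k → ℂ, Hyponormal
      (∑ j : Fin (k + 1), (Fin.cons 1 lam : Fin (k + 1) → ℂ) j • T ^ (j.1 + 1))) :
    WeaklyKHyponormal (k + 1) T := by
  have hne (z : ℂ) (hz : z ≠ 0) (lam : Fin k → ℂ) : Hyponormal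
      (∑ j : Fin (k + 1), (Fin.cons z lam : Fin (k + 1) → ℂ) j • T ^ (j.1 + 1)) := by
    convert (h (z⁻¹ • lam)).smul z using 1
    simp [Fin.sum_univ_succ, smul_smul, Finset.smul_sum, hz]
  intro lam x
  rw [← Fin.cons_self_tail lam]
  let P (z : ℂ) : E →L[ℂ] E :=
    ∑ j : Fin (k + 1), (Fin.cons z (Fin.tail lam) : Fin (k + 1) → ℂ) j • T ^ (j.1 + 1)
  have hP : Continuous P := by
    simp only [P, Fin.sum_univ_succ, Fin.cons_zero, Fin.cons_succ]
    fun_prop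
  have hclosed : IsClosed {z : ℂ | ‖adjoint (P z) x‖ ≤ ‖P z x‖} :=
    isClosed_le (((adjoint.continuous.comp hP).clm_apply continuous_const).norm)
      ((hP.clm_apply continuous_const).norm)
  exact hclosed.closure_subset_iff.mpr (fun z hz => hne z hz _ x)
    ((dense_compl_singleton (0 : ℂ)) (lam 0))

lemma monotone_of_hyponormal_weightedShift {α : ℕ → ℝ} (hα : ∀ n, 0 ≤ α n) {W : H →L[ℂ] H}
    (hW : IsWeightedShift α W) (h : Hyponormal W) : Monotone α := by
  refine monotone_nat_of_le_succ fun n => ?_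
  have he (m : ℕ) : ‖e m‖ = 1 := by simp [e, lp.norm_single]
  have := h (e (n + 1))
  rwa [adjoint_weightedShift_e_succ hW, hW, norm_smul, norm_smul, he, he, mul_one, mul_one,
    Complex.norm_of_nonneg (hα _), Complex.norm_of_nonneg (hα _)] at this

lemma monotone_of_u_nonneg {α : ℕ → ℝ} (hα : ∀ n, 0 ≤ α n) (h : ∀ n : ℕ, 0 ≤ u α n) :
    Monotone α := by
  refine monotone_nat_of_le_succ fun n => ?_
  have := h (n + 1)
  rw [u, wsq_eq_zext_sq, wsq_eq_zext_sq, zext_natCast, sub_nonneg, Nat.cast_succ,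
    add_sub_cancel_right, zext_natCast] at this
  exact (sq_le_sq₀ (hα _) (hα _)).mp this

/-- A weighted shift is quartically hyponormal iff the quadratic form `Δ` is
nonnegative for all `a, b, c ∈ ℂ` and all `x ∈ ℓ²`. -/
theorem quartically_hyponormal_iff_Delta_nonneg (α : ℕ → ℝ)
    (hbd : ∃ C : ℝ, ∀ n, α n ≤ C) (hpos : ∀ n, 0 < α n)
    (W : H →L[ℂ] H) (hW : IsWeightedShift α W) :
    WeaklyKHyponormal 4 W ↔
      ∀ a b c : ℂ, ∀ x : H,
        0 ≤ ‖c‖ ^ 2 * r α 0 * ‖x 0‖ ^ 2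
          + qform (Theta1 α) ![(starRingEnd ℂ) b * x 0, (starRingEnd ℂ) c * x 1]
          + qform (Theta2 α)
              ![(starRingEnd ℂ) a * x 0, (starRingEnd ℂ) b * x 1, (starRingEnd ℂ) c * x 2]
          + ∑' i : ℕ, qform (DeltaMat α i)
              ![x i, (starRingEnd ℂ) a * x (i + 1), (starRingEnd ℂ) b * x (i + 2),
                (starRingEnd ℂ) c * x (i + 3)] := by
  have hα (n : ℕ) : 0 ≤ α n := (hpos n).le
  constructor
  · intro h a b c x
    have hmono : Monotone α := by
      refine monotone_of_hyponormal_weightedShift hα hW ?_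
      simpa [Fin.sum_univ_four] using h ![1, 0, 0, 0]
    rw [Delta_eq_selfCommutator hα hmono hW, sub_nonneg]
    exact pow_le_pow_left₀ (norm_nonneg _) (h _ x) 2
  · intro h
    have hmono : Monotone α := by
      refine monotone_of_u_nonneg hα fun n => ?_
      have hn := h 0 0 0 (e n)
      rw [tsum_eq_single n fun m hm => by simp [qform, Fin.sum_univ_four, e, hm]] at hn
      simpa [qform, Fin.sum_univ_four, Fin.sum_univ_three, DeltaMat, e] using hn
    refine weaklyKHyponormal_of_forall_cons_one fun lam x => ?_
    have hx := h (lam 0) (lam 1) (lam 2) x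
    rw [Delta_eq_selfCommutator hα hmono hW, sub_nonneg] at hx
    have hlam : (Fin.cons 1 lam : Fin 4 → ℂ) = ![1, lam 0, lam 1, lam 2] := by
      ext j
      fin_cases j <;> rfl
    rw [hlam]
    exact le_of_sq_le_sq hx (norm_nonneg _)
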